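/- Let f, g : (A, d^A) → (B, d^B) be morphisms of twisted complexes over R and let r ≥ 0. Giving an r-homotopy h : A → P_r(B) from f to g is equivalent to giving a family of bigraded maps ĥ_m : A → B of bidegree (−m+r, −m+r−1), m ≥ 0, such that for all m ≥ 0: Σ_{i+j=m} ((−1)^{i+r} d_i^B ĥ_j + (−1)^i ĥ_i d_j^A) equals 0 if m < r, and equals g_{m−r} − f_{m−r} if m ≥ r. Explicitly, h ↦ (ĥ_m) with ĥ_m := ∂⁰∘h_m (where ∂⁰(x,y,z) = y) is a bijection between r-homotopies from f to g and such families, with inverse h_m(x) := (f_m(x), ĥ_m(x), g_m(x)). -/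

import Mathlib

open Finset

noncomputable section

/-- A `(ℤ,ℤ)`-bigraded `R`-module. -/
structure Bigraded (R : Type) [CommRing R] where
  M : ℤ → ℤ → Type
  [acg : ∀ i j, AddCommGroup (M i j)]
  [mod : ∀ i j, Module R (M i j)]

attribute [instance] Bigraded.acg Bigraded.mod

variable {R : Type} [CommRing R]

/-- Transport along equalities of bidegrees. -/
def Bigraded.cast (A : Bigraded R) {i i' j j' : ℤ} (hi : i = i') (hj : j = j') :
    A.M i j →ₗ[R] A.M i' j' := by subst hi; subst hj; exact LinearMap.id

/-- Maps of bigraded modules of bidegree `(p,q)`. -/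
abbrev GMap (A B : Bigraded R) (p q : ℤ) : Type :=
  ∀ i j : ℤ, A.M i j →ₗ[R] B.M (i + p) (j + q)

/-- Change the recorded bidegree of a graded map along equalities of bidegrees. -/
def grecast {A B : Bigraded R} {p q : ℤ} (p' q' : ℤ) (hp : p = p') (hq : q = q')
    (f : GMap A B p q) : GMap A B p' q' :=
  fun i j => (B.cast (by rw [hp]) (by rw [hq])).comp (f i j)

/-- Composition of graded maps: apply `f` first, then `g`. -/
def gcomp {A B C : Bigraded R} {p q p' q' : ℤ} (g : GMap B C p' q') (f : GMap A B p q) :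
    GMap A C (p + p') (q + q') :=
  fun i j => (C.cast (by ring) (by ring)).comp ((g (i + p) (j + q)).comp (f i j))

/-- The identity as a graded map of bidegree `(0,0)`. -/
def idG (A : Bigraded R) : GMap A A 0 0 := fun i j => A.cast (by ring) (by ring)

/-- An element of `wbimod(A,B)_u^v`, i.e. a family of bigraded maps `f_m : A → B` of
bidegree `(u-m, v-m)` for `m ≥ 0`. -/
abbrev WMap (A B : Bigraded R) (u v : ℤ) : Type :=
  ∀ m : ℕ, GMap A B (u - (m : ℤ)) (v - (m : ℤ))

/-- The family of maps `(d_m)` makes `A` into a twisted complex: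
`∑_{i+j=m} (-1)^i d_i d_j = 0` for all `m ≥ 0`. -/
def IsTwDiff (A : Bigraded R) (d : WMap A A 0 1) : Prop :=
  ∀ m : ℕ, ∑ ij ∈ (antidiagonal m).attach,
      ((-1 : ℤ) ^ ij.1.1) •
        grecast (0 - (m : ℤ)) (2 - (m : ℤ))
          (by have := mem_antidiagonal.mp ij.2; omega)
          (by have := mem_antidiagonal.mp ij.2; omega)
          (gcomp (d ij.1.1) (d ij.1.2)) = 0

/-- The family `(f_m)` is a morphism of twisted complexes from `(A, dA)` to `(B, dB)`:
`∑_{i+j=m} d_i^B f_j = ∑_{i+j=m} (-1)^i f_i d_j^A` for all `m ≥ 0`. -/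
def IsTwMor {A B : Bigraded R} (dA : WMap A A 0 1) (dB : WMap B B 0 1)
    (f : WMap A B 0 0) : Prop :=
  ∀ m : ℕ,
    (∑ ij ∈ (antidiagonal m).attach,
      grecast (0 - (m : ℤ)) (1 - (m : ℤ))
        (by have := mem_antidiagonal.mp ij.2; omega)
        (by have := mem_antidiagonal.mp ij.2; omega)
        (gcomp (dB ij.1.1) (f ij.1.2)))
    = ∑ ij ∈ (antidiagonal m).attach,
      ((-1 : ℤ) ^ ij.1.1) •
        grecast (0 - (m : ℤ)) (1 - (m : ℤ))
          (by have := mem_antidiagonal.mp ij.2; omega)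
          (by have := mem_antidiagonal.mp ij.2; omega)
          (gcomp (f ij.1.1) (dA ij.1.2))

/-- A twisted complex (multicomplex) over `R`. -/
structure TwComplex (R : Type) [CommRing R] extends Bigraded R where
  d : WMap toBigraded toBigraded 0 1
  isTw : IsTwDiff toBigraded d

/-- A morphism of twisted complexes. -/
structure TwMorphism (A B : TwComplex R) where
  f : WMap A.toBigraded B.toBigraded 0 0
  isMor : IsTwMor A.d B.d f

/-- Composition of families: `(g ∘ f)_m = ∑_{i+j=m} g_i f_j`. -/
def compFam {A B C : Bigraded R} (g : WMap B C 0 0) (f : WMap A B 0 0) : WMap A C 0 0 :=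
  fun m => ∑ ij ∈ (antidiagonal m).attach,
    grecast (0 - (m : ℤ)) (0 - (m : ℤ))
      (by have := mem_antidiagonal.mp ij.2; omega)
      (by have := mem_antidiagonal.mp ij.2; omega)
      (gcomp (g ij.1.1) (f ij.1.2))

/-- A strict family: concentrated in stage `0`. -/
def strictW {A B : Bigraded R} (g : GMap A B 0 0) : WMap A B 0 0 :=
  fun m => if h : m = 0 then grecast (0 - (m : ℤ)) (0 - (m : ℤ)) (by omega) (by omega) g else 0

/-- The identity family of maps. -/
def idW (A : Bigraded R) : WMap A A 0 0 := strictW (idG A)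

/-! ## The `r`-path of a twisted complex -/

/-- Underlying bigraded module of the `r`-path: `P_r(A)_i^j = A_i^j ⊕ A_{i+r}^{j+r-1} ⊕ A_i^j`. -/
def pathBG (r : ℕ) (A : Bigraded R) : Bigraded R where
  M i j := A.M i j × (A.M (i + r) (j + r - 1) × A.M i j)
  acg := fun _ _ => inferInstance
  mod := fun _ _ => inferInstance

/-- First projection of the path. -/
def pp1 (r : ℕ) (A : Bigraded R) (i j : ℤ) : (pathBG r A).M i j →ₗ[R] A.M i j :=
  LinearMap.fst R (A.M i j) (A.M (i + r) (j + r - 1) × A.M i j)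

/-- Middle projection of the path. -/
def pp2 (r : ℕ) (A : Bigraded R) (i j : ℤ) : (pathBG r A).M i j →ₗ[R] A.M (i + r) (j + r - 1) :=
  (LinearMap.fst R (A.M (i + r) (j + r - 1)) (A.M i j)).comp
    (LinearMap.snd R (A.M i j) (A.M (i + r) (j + r - 1) × A.M i j))

/-- Last projection of the path. -/
def pp3 (r : ℕ) (A : Bigraded R) (i j : ℤ) : (pathBG r A).M i j →ₗ[R] A.M i j :=
  (LinearMap.snd R (A.M (i + r) (j + r - 1)) (A.M i j)).comp
    (LinearMap.snd R (A.M i j) (A.M (i + r) (j + r - 1) × A.M i j))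

/-- The structure maps `D_m` of the `r`-path:
`D_r(x,y,z) = (d_r x, -x - d_r y + z, d_r z)` and
`D_m(x,y,z) = (d_m x, (-1)^{m+r+1} d_m y, d_m z)` for `m ≠ r`. -/
def pathDRaw (r : ℕ) {A : Bigraded R} (d : WMap A A 0 1) :
    WMap (pathBG r A) (pathBG r A) 0 1 :=
  fun m i j =>
    LinearMap.prod
      ((d m i j).comp (pp1 r A i j))
      (LinearMap.prod
        (if h : m = r then
          - (A.cast (by omega) (by omega)).comp (pp1 r A i j)
          - (A.cast (by ring) (by ring)).comp ((d m (i + r) (j + r - 1)).comp (pp2 r A i j))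
          + (A.cast (by omega) (by omega)).comp (pp3 r A i j)
        else
          ((-1 : ℤ) ^ (m + r + 1)) •
            (A.cast (by ring) (by ring)).comp ((d m (i + r) (j + r - 1)).comp (pp2 r A i j)))
        ((d m i j).comp (pp3 r A i j)))

/-- `∂⁻ : P_r(A) → A`, `(x,y,z) ↦ x`, as a graded map of bidegree `(0,0)`. -/
def projMinusG (r : ℕ) (A : Bigraded R) : GMap (pathBG r A) A 0 0 :=
  fun i j => (A.cast (by ring) (by ring)).comp (pp1 r A i j)

/-- `∂⁺ : P_r(A) → A`, `(x,y,z) ↦ z`, as a graded map of bidegree `(0,0)`. -/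
def projPlusG (r : ℕ) (A : Bigraded R) : GMap (pathBG r A) A 0 0 :=
  fun i j => (A.cast (by ring) (by ring)).comp (pp3 r A i j)

/-- `∂⁰ : P_r(A) → A`, `(x,y,z) ↦ y`, of bidegree `(r, r-1)`. -/
def proj0G (r : ℕ) (A : Bigraded R) : GMap (pathBG r A) A (r : ℤ) ((r : ℤ) - 1) :=
  fun i j => (A.cast (by ring) (by ring)).comp (pp2 r A i j)

/-- `∂⁻` as a strict morphism (family). -/
def projMinusW (r : ℕ) (A : Bigraded R) : WMap (pathBG r A) A 0 0 := strictW (projMinusG r A)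

/-- `∂⁺` as a strict morphism (family). -/
def projPlusW (r : ℕ) (A : Bigraded R) : WMap (pathBG r A) A 0 0 := strictW (projPlusG r A)

/-- `ι : A → P_r(A)`, `x ↦ (x,0,x)`, as a graded map of bidegree `(0,0)`. -/
def iotaG (r : ℕ) (A : Bigraded R) : GMap A (pathBG r A) 0 0 :=
  fun i j => LinearMap.prod (A.cast (by ring) (by ring))
    (LinearMap.prod 0 (A.cast (by ring) (by ring)))

/-- `ι` as a strict morphism (family). -/
def iotaW (r : ℕ) (A : Bigraded R) : WMap A (pathBG r A) 0 0 := strictW (iotaG r A)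

/-- An `r`-homotopy from `f` to `g`: a morphism of twisted complexes `h : A → P_r(B)` with
`∂⁻ ∘ h = f` and `∂⁺ ∘ h = g`. -/
def IsRHomotopy (r : ℕ) {A B : Bigraded R} (dA : WMap A A 0 1) (dB : WMap B B 0 1)
    (f g : WMap A B 0 0) (h : WMap A (pathBG r B) 0 0) : Prop :=
  IsTwMor dA (pathDRaw r dB) h ∧ compFam (projMinusW r B) h = f ∧
    compFam (projPlusW r B) h = g

/-- `f` and `g` are `r`-homotopic. -/
def RHomotopic (r : ℕ) {A B : Bigraded R} (dA : WMap A A 0 1) (dB : WMap B B 0 1)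
    (f g : WMap A B 0 0) : Prop :=
  ∃ h, IsRHomotopy r dA dB f g h

/-- The equivalent description of an `r`-homotopy from `f` to `g` as a family of maps
`ĥ_m : A → B` of bidegree `(-m+r, -m+r-1)` satisfying the relations `(H_{m1})`. -/
def IsHtpFam (r : ℕ) {A B : Bigraded R} (dA : WMap A A 0 1) (dB : WMap B B 0 1)
    (f g : WMap A B 0 0) (hh : WMap A B (r : ℤ) ((r : ℤ) - 1)) : Prop :=
  ∀ m : ℕ,
    (∑ ij ∈ (antidiagonal m).attach,
      (((-1 : ℤ) ^ (ij.1.1 + r)) •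
        grecast ((r : ℤ) - m) ((r : ℤ) - m)
          (by have := mem_antidiagonal.mp ij.2; omega)
          (by have := mem_antidiagonal.mp ij.2; omega)
          (gcomp (dB ij.1.1) (hh ij.1.2))
      + ((-1 : ℤ) ^ ij.1.1) •
        grecast ((r : ℤ) - m) ((r : ℤ) - m)
          (by have := mem_antidiagonal.mp ij.2; omega)
          (by have := mem_antidiagonal.mp ij.2; omega)
          (gcomp (hh ij.1.1) (dA ij.1.2))))
    = if hm : r ≤ m then
        grecast ((r : ℤ) - m) ((r : ℤ) - m) (by omega) (by omega) (g (m - r) - f (m - r))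
      else 0

/-- `f` is an `r`-homotopy equivalence. -/
def IsRHomotopyEquiv (r : ℕ) {A B : Bigraded R} (dA : WMap A A 0 1) (dB : WMap B B 0 1)
    (f : WMap A B 0 0) : Prop :=
  ∃ g : WMap B A 0 0, IsTwMor dB dA g ∧
    RHomotopic r dB dB (compFam f g) (idW B) ∧
    RHomotopic r dA dA (compFam g f) (idW A)

/-- Extract from `h : A → P_r(B)` the family `ĥ_m := ∂⁰ ∘ h_m`. -/
def extractFam (r : ℕ) {A B : Bigraded R} (h : WMap A (pathBG r B) 0 0) :
    WMap A B (r : ℤ) ((r : ℤ) - 1) :=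
  fun m => grecast ((r : ℤ) - m) (((r : ℤ) - 1) - m) (by ring) (by ring)
    (gcomp (proj0G r B) (h m))

/-- Build from `f`, `g` and a family `ĥ` the map `h : A → P_r(B)`,
`h_m(x) = (f_m(x), ĥ_m(x), g_m(x))`. -/
def buildH (r : ℕ) {A B : Bigraded R} (f g : WMap A B 0 0)
    (hh : WMap A B (r : ℤ) ((r : ℤ) - 1)) : WMap A (pathBG r B) 0 0 :=
  fun m i j =>
    LinearMap.prod (f m i j)
      (LinearMap.prod ((B.cast (by ring) (by ring)).comp (hh m i j)) (g m i j))
section Casts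

variable {A B C : Bigraded R} {r : ℕ}

theorem Bigraded.cast_rfl {i j : ℤ} (hi : i = i) (hj : j = j) (x : A.M i j) :
    A.cast hi hj x = x := rfl

theorem Bigraded.cast_cast {i i' i'' j j' j'' : ℤ} (hi : i = i') (hj : j = j')
    (hi' : i' = i'') (hj' : j' = j'') (x : A.M i j) :
    A.cast hi' hj' (A.cast hi hj x) = A.cast (hi.trans hi') (hj.trans hj') x := by
  subst hi hj hi' hj'; rfl

theorem Bigraded.cast_injective {i i' j j' : ℤ} (hi : i = i') (hj : j = j') :
    Function.Injective (A.cast hi hj) := by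
  subst hi hj; exact Function.injective_id

theorem GMap.apply_cast {p q : ℤ} (f : GMap A B p q) {i i' j j' : ℤ} (hi : i = i')
    (hj : j = j') (x : A.M i j) :
    f i' j' (A.cast hi hj x) =
      B.cast (congrArg (· + p) hi) (congrArg (· + q) hj) (f i j x) := by
  subst hi hj; rfl

theorem pp1_cast {i i' j j' : ℤ} (hi : i = i') (hj : j = j') (x : (pathBG r A).M i j) :
    pp1 r A i' j' ((pathBG r A).cast hi hj x) = A.cast hi hj (pp1 r A i j x) := by
  subst hi hj; rfl

theorem pp2_cast {i i' j j' : ℤ} (hi : i = i') (hj : j = j') (x : (pathBG r A).M i j) :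
    pp2 r A i' j' ((pathBG r A).cast hi hj x) =
      A.cast (congrArg (· + (r : ℤ)) hi) (congrArg (· + (r : ℤ) - 1) hj) (pp2 r A i j x) := by
  subst hi hj; rfl

theorem pp3_cast {i i' j j' : ℤ} (hi : i = i') (hj : j = j') (x : (pathBG r A).M i j) :
    pp3 r A i' j' ((pathBG r A).cast hi hj x) = A.cast hi hj (pp3 r A i j x) := by
  subst hi hj; rfl

theorem grecast_apply {p q p' q' : ℤ} (hp : p = p') (hq : q = q') (f : GMap A B p q) (i j : ℤ)
    (x : A.M i j) :
    grecast p' q' hp hq f i j x = B.cast (by rw [hp]) (by rw [hq]) (f i j x) := rfl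

theorem gcomp_apply {p q p' q' : ℤ} (g : GMap B C p' q') (f : GMap A B p q) (i j : ℤ)
    (x : A.M i j) :
    gcomp g f i j x = C.cast (by ring) (by ring) (g (i + p) (j + q) (f i j x)) := rfl

end Casts

section Path

variable {A B : Bigraded R} {r : ℕ}

theorem path_ext {i j : ℤ} {x y : (pathBG r A).M i j} (h1 : pp1 r A i j x = pp1 r A i j y)
    (h2 : pp2 r A i j x = pp2 r A i j y) (h3 : pp3 r A i j x = pp3 r A i j y) : x = y :=
  Prod.ext h1 (Prod.ext h2 h3)

theorem pp1_pathDRaw (d : WMap A A 0 1) (m : ℕ) (i j : ℤ) (x : (pathBG r A).M i j) :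
    pp1 r A _ _ (pathDRaw r d m i j x) = d m i j (pp1 r A i j x) := rfl

theorem pp3_pathDRaw (d : WMap A A 0 1) (m : ℕ) (i j : ℤ) (x : (pathBG r A).M i j) :
    pp3 r A _ _ (pathDRaw r d m i j x) = d m i j (pp3 r A i j x) := rfl

theorem pp2_pathDRaw (d : WMap A A 0 1) (m : ℕ) (i j : ℤ) (x : (pathBG r A).M i j) :
    pp2 r A _ _ (pathDRaw r d m i j x) =
      (if h : m = r then
          A.cast (by omega) (by omega) (pp3 r A i j x) -
            A.cast (by omega) (by omega) (pp1 r A i j x)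
        else 0) -
      ((-1 : ℤ) ^ (m + r)) •
        A.cast (by ring) (by ring) (d m (i + r) (j + r - 1) (pp2 r A i j x)) := by
  change (dite (m = r) _ _ : (pathBG r A).M i j →ₗ[R]
    A.M (i + (0 - (m : ℤ)) + r) (j + (1 - (m : ℤ)) + r - 1)) x = _
  split_ifs with h
  · subst h
    simp only [LinearMap.add_apply, LinearMap.sub_apply, LinearMap.neg_apply,
      LinearMap.comp_apply, Even.neg_one_pow ⟨m, rfl⟩, one_smul]
    abel
  · simp only [pow_succ, mul_neg_one, neg_smul, zero_sub]
    rfl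

/-- The family `∂⁻ ∘ h`, without transports. -/
def fstFam (h : WMap A (pathBG r B) 0 0) : WMap A B 0 0 :=
  fun m i j => (pp1 r B _ _).comp (h m i j)

/-- The family `∂⁺ ∘ h`, without transports. -/
def lastFam (h : WMap A (pathBG r B) 0 0) : WMap A B 0 0 :=
  fun m i j => (pp3 r B _ _).comp (h m i j)

theorem fstFam_apply (h : WMap A (pathBG r B) 0 0) (m : ℕ) (i j : ℤ) (x : A.M i j) :
    fstFam h m i j x = pp1 r B _ _ (h m i j x) := rfl

theorem lastFam_apply (h : WMap A (pathBG r B) 0 0) (m : ℕ) (i j : ℤ) (x : A.M i j) :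
    lastFam h m i j x = pp3 r B _ _ (h m i j x) := rfl

theorem extractFam_apply (h : WMap A (pathBG r B) 0 0) (m : ℕ) (i j : ℤ) (x : A.M i j) :
    extractFam r h m i j x = B.cast (by ring) (by ring) (pp2 r B _ _ (h m i j x)) := by
  simp only [extractFam, grecast_apply, gcomp_apply, proj0G, LinearMap.comp_apply,
    Bigraded.cast_cast]

theorem compFam_strictW {C : Bigraded R} (g : GMap B C 0 0) (h : WMap A B 0 0) (m : ℕ) (i j : ℤ)
    (x : A.M i j) :
    compFam (strictW g) h m i j x = C.cast (by ring) (by ring) (g _ _ (h m i j x)) := by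
  have key : compFam (strictW g) h m =
      grecast _ _ (by simp) (by simp) (gcomp (strictW g 0) (h m)) := by
    rw [compFam, Finset.sum_eq_single ⟨(0, m), by simp⟩]
    · rintro ⟨⟨a, b⟩, hab⟩ - hne
      have ha : a ≠ 0 := by
        rintro rfl
        exact hne (by simpa using hab)
      funext i j
      ext x
      simp [grecast_apply, gcomp_apply, strictW, ha]
    · simp
  rw [key]
  simp [grecast_apply, gcomp_apply, strictW, Bigraded.cast_cast]

theorem compFam_projMinusW (h : WMap A (pathBG r B) 0 0) :
    compFam (projMinusW r B) h = fstFam h := by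
  funext m i j
  ext x
  rw [projMinusW, compFam_strictW, projMinusG, LinearMap.comp_apply, Bigraded.cast_cast]
  rfl

theorem compFam_projPlusW (h : WMap A (pathBG r B) 0 0) :
    compFam (projPlusW r B) h = lastFam h := by
  funext m i j
  ext x
  rw [projPlusW, compFam_strictW, projPlusG, LinearMap.comp_apply, Bigraded.cast_cast]
  rfl

theorem fstFam_buildH (f g : WMap A B 0 0) (hh : WMap A B (r : ℤ) ((r : ℤ) - 1)) :
    fstFam (buildH r f g hh) = f := rfl

theorem lastFam_buildH (f g : WMap A B 0 0) (hh : WMap A B (r : ℤ) ((r : ℤ) - 1)) :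
    lastFam (buildH r f g hh) = g := rfl

theorem extractFam_buildH (f g : WMap A B 0 0) (hh : WMap A B (r : ℤ) ((r : ℤ) - 1)) :
    extractFam r (buildH r f g hh) = hh := by
  funext m i j
  ext x
  rw [extractFam_apply]
  change B.cast _ _ (B.cast _ _ (hh m i j x)) = _
  rw [Bigraded.cast_cast, Bigraded.cast_rfl]

theorem buildH_extractFam (h : WMap A (pathBG r B) 0 0) :
    buildH r (fstFam h) (lastFam h) (extractFam r h) = h := by
  funext m i j
  ext x
  refine path_ext rfl ?_ rfl
  change B.cast _ _ (extractFam r h m i j x) = _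
  rw [extractFam_apply, Bigraded.cast_cast, Bigraded.cast_rfl]

/-- The relation defining morphisms of twisted complexes, evaluated at elements. -/
theorem isTwMor_iff {dA : WMap A A 0 1} {dB : WMap B B 0 1} {f : WMap A B 0 0} :
    IsTwMor dA dB f ↔ ∀ (m : ℕ) (i j : ℤ) (x : A.M i j),
      ∑ ab ∈ (antidiagonal m).attach,
        B.cast (i' := i + (0 - m)) (j' := j + (1 - m))
          (by have := mem_antidiagonal.mp ab.2; omega)
          (by have := mem_antidiagonal.mp ab.2; omega)
          (dB ab.1.1 _ _ (f ab.1.2 i j x)) =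
      ∑ ab ∈ (antidiagonal m).attach, ((-1 : ℤ) ^ ab.1.1) •
        B.cast (i' := i + (0 - m)) (j' := j + (1 - m))
          (by have := mem_antidiagonal.mp ab.2; omega)
          (by have := mem_antidiagonal.mp ab.2; omega)
          (f ab.1.1 _ _ (dA ab.1.2 i j x)) := by
  simp only [IsTwMor, funext_iff, LinearMap.ext_iff, Finset.sum_apply, LinearMap.sum_apply,
    Pi.smul_apply, LinearMap.smul_apply, grecast_apply, gcomp_apply, Bigraded.cast_cast]

/-- The relations `(H_{m1})`, evaluated at elements. -/
theorem isHtpFam_iff {dA : WMap A A 0 1} {dB : WMap B B 0 1} {f g : WMap A B 0 0}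
    {hh : WMap A B (r : ℤ) ((r : ℤ) - 1)} :
    IsHtpFam r dA dB f g hh ↔ ∀ (m : ℕ) (i j : ℤ) (x : A.M i j),
      ∑ ab ∈ (antidiagonal m).attach,
        (((-1 : ℤ) ^ (ab.1.1 + r)) •
          B.cast (i' := i + (r - m)) (j' := j + (r - m))
            (by have := mem_antidiagonal.mp ab.2; omega)
            (by have := mem_antidiagonal.mp ab.2; omega)
            (dB ab.1.1 _ _ (hh ab.1.2 i j x)) +
        ((-1 : ℤ) ^ ab.1.1) •
          B.cast (i' := i + (r - m)) (j' := j + (r - m))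
            (by have := mem_antidiagonal.mp ab.2; omega)
            (by have := mem_antidiagonal.mp ab.2; omega)
            (hh ab.1.1 _ _ (dA ab.1.2 i j x))) =
      ∑ ab ∈ (antidiagonal m).attach,
        if h : ab.1.1 = r then
          B.cast (by have := mem_antidiagonal.mp ab.2; omega)
            (by have := mem_antidiagonal.mp ab.2; omega)
            (g ab.1.2 i j x - f ab.1.2 i j x)
        else 0 := by
  simp only [IsHtpFam, funext_iff, LinearMap.ext_iff]
  refine forall_congr' fun m => forall_congr' fun i => forall_congr' fun j =>
    forall_congr' fun x => ?_
  simp only [Finset.sum_apply, LinearMap.sum_apply, Pi.add_apply, LinearMap.add_apply,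
    Pi.smul_apply, LinearMap.smul_apply, grecast_apply, gcomp_apply, Bigraded.cast_cast]
  refine Eq.congr rfl ?_
  split_ifs with hm
  · rw [Finset.sum_eq_single ⟨(r, m - r), by simp [hm]⟩]
    · simp [grecast_apply]
    · rintro ⟨⟨a, b⟩, hab⟩ - hne
      refine dif_neg ?_
      rintro rfl
      have := mem_antidiagonal.mp hab
      exact hne (by simp only [Subtype.mk.injEq, Prod.mk.injEq, true_and] at *; omega)
    · simp
  · symm
    refine Finset.sum_eq_zero fun ab _ => dif_neg ?_
    have := mem_antidiagonal.mp ab.2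
    omega

/-- A family of maps into the `r`-path is a morphism of twisted complexes if and only if its
outer components are and its middle component satisfies `(H_{m1})`. -/
theorem isTwMor_path_iff {dA : WMap A A 0 1} {dB : WMap B B 0 1} {h : WMap A (pathBG r B) 0 0} :
    IsTwMor dA (pathDRaw r dB) h ↔ IsTwMor dA dB (fstFam h) ∧ IsTwMor dA dB (lastFam h) ∧
      IsHtpFam r dA dB (fstFam h) (lastFam h) (extractFam r h) := by
  simp only [isTwMor_iff, isHtpFam_iff, ← forall_and]
  refine forall_congr' fun m => forall_congr' fun i => forall_congr' fun j =>
    forall_congr' fun x => ?_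
  have split {i j : ℤ} (y z : (pathBG r B).M i j) : y = z ↔ pp1 r B i j y = pp1 r B i j z ∧
      pp3 r B i j y = pp3 r B i j z ∧ pp2 r B i j y = pp2 r B i j z :=
    ⟨by rintro rfl; simp, fun h => path_ext h.1 h.2.2 h.2.1⟩
  rw [split]
  simp only [map_sum, map_zsmul, pp1_cast, pp3_cast, pp2_cast, pp1_pathDRaw, pp3_pathDRaw,
    pp2_pathDRaw, fstFam_apply, lastFam_apply, extractFam_apply]
  refine and_congr Iff.rfl (and_congr Iff.rfl ?_)
  have hi : i + (0 - (m : ℤ)) + r = i + (r - m) := by ring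
  have hj : j + (1 - (m : ℤ)) + r - 1 = j + (r - m) := by ring
  rw [← (B.cast_injective hi hj).eq_iff]
  simp only [map_sum, map_zsmul, map_sub, apply_dite (B.cast _ _), map_zero, Bigraded.cast_cast,
    GMap.apply_cast, Finset.sum_add_distrib, Finset.sum_sub_distrib]
  rw [sub_eq_iff_eq_add', eq_comm]

end Path

/-- For morphisms of twisted complexes `f, g : (A,d^A) → (B,d^B)` and `r ≥ 0`,
giving an `r`-homotopy `h : A → P_r(B)` from `f` to `g` is equivalent to giving a family of maps
`ĥ_m : A → B` of bidegree `(-m+r, -m+r-1)` satisfying the relations `(H_{m1})`.  Explicitly,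
`h ↦ ∂⁰ ∘ h_m` is a bijection between `r`-homotopies from `f` to `g` and such families, with
inverse `ĥ ↦ (h_m(x) = (f_m(x), ĥ_m(x), g_m(x)))`. -/
theorem rHomotopy_iff_family {R : Type} [CommRing R] (r : ℕ) (A B : TwComplex R)
    (f g : TwMorphism A B) :
    (∀ h : WMap A.toBigraded (pathBG r B.toBigraded) 0 0,
        IsRHomotopy r A.d B.d f.f g.f h → IsHtpFam r A.d B.d f.f g.f (extractFam r h)) ∧
    (∀ hh : WMap A.toBigraded B.toBigraded (r : ℤ) ((r : ℤ) - 1),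
        IsHtpFam r A.d B.d f.f g.f hh → IsRHomotopy r A.d B.d f.f g.f (buildH r f.f g.f hh)) ∧
    (∀ hh : WMap A.toBigraded B.toBigraded (r : ℤ) ((r : ℤ) - 1),
        extractFam r (buildH r f.f g.f hh) = hh) ∧
    (∀ h : WMap A.toBigraded (pathBG r B.toBigraded) 0 0,
        IsRHomotopy r A.d B.d f.f g.f h → buildH r f.f g.f (extractFam r h) = h) := by
  simp only [IsRHomotopy, compFam_projMinusW, compFam_projPlusW, isTwMor_path_iff]
  refine ⟨?_, fun hh H => ⟨⟨f.isMor, g.isMor, ?_⟩, rfl, rfl⟩, extractFam_buildH _ _, ?_⟩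
  · rintro h ⟨⟨-, -, H⟩, hf, hg⟩
    rwa [hf, hg] at H
  · rwa [extractFam_buildH]
  · rintro h ⟨-, hf, hg⟩
    rw [← hf, ← hg, buildH_extractFam]
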